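/- arXiv:1403.4434 — 2 statements merged into one kernel-verified Lean document; each statement's English description precedes it below -/
import Mathlib

section
/- Let 0 < γ < 1, let n ≥ 1, and let 0 = t_0 < t_1 < ⋯ < t_n be a strictly increasing mesh. Define the non-uniform L1 weights T_{m,n}^{(γ)} = ((t_n − t_m)^(1−γ) − (t_n − t_{m+1})^(1−γ)) / (t_{m+1} − t_m) for 0 ≤ m ≤ n − 1. Then T_{m,n}^{(γ)} > 0 for every 0 ≤ m ≤ n − 1, and the weights are strictly increasing in m: T_{m,n}^{(γ)} < T_{m+1,n}^{(γ)} for every 0 ≤ m ≤ n − 2. -/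
/-- The non-uniform L1 weights
`T_{m,n}^{(γ)} = ((t_n − t_m)^(1−γ) − (t_n − t_{m+1})^(1−γ)) / (t_{m+1} − t_m)`. -/
noncomputable def Tweight (γ : ℝ) (t : ℕ → ℝ) (m n : ℕ) : ℝ :=
  ((t n - t m) ^ (1 - γ) - (t n - t (m + 1)) ^ (1 - γ)) / (t (m + 1) - t m)

/-- for `0 < γ < 1` and a strictly increasing mesh
`0 = t_0 < t_1 < ⋯ < t_n` (`n ≥ 1`), the non-uniform L1 weights are strictly
positive for `0 ≤ m ≤ n−1` and strictly increasing in `m` for `0 ≤ m ≤ n−2`. -/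
theorem stmt_1 (γ : ℝ) (hγ0 : 0 < γ) (hγ1 : γ < 1) (n : ℕ) (hn : 1 ≤ n)
    (t : ℕ → ℝ) (ht0 : t 0 = 0) (ht : ∀ m, m < n → t m < t (m + 1)) :
    (∀ m, m + 1 ≤ n → 0 < Tweight γ t m n) ∧
    (∀ m, m + 2 ≤ n → Tweight γ t m n < Tweight γ t (m + 1) n) := by
  have le_last : ∀ m, m ≤ n → t m ≤ t n := fun m hm => by
    induction hm using Nat.decreasingInduction with
    | self => exact le_rfl
    | of_succ k hk ih => exact (ht k hk).le.trans ih
  refine ⟨fun m hm => ?_, fun m hm => ?_⟩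
  · have h₁ := ht m hm
    have h₂ := le_last (m + 1) hm
    exact div_pos (sub_pos.2 (Real.rpow_lt_rpow (by linarith) (by linarith) (by linarith)))
      (sub_pos.2 h₁)
  · have h₁ := ht m (by lia)
    have h₂ := ht (m + 1) (by lia)
    have h₃ := le_last (m + 1 + 1) hm
    have slope_lt := (Real.strictConcaveOn_rpow (p := 1 - γ) (by linarith)
      (by linarith)).slope_anti_adjacent (x := t n - t (m + 1 + 1)) (y := t n - t (m + 1))
      (z := t n - t m) (Set.mem_Ici.2 (by linarith)) (Set.mem_Ici.2 (by linarith))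
      (by linarith) (by linarith)
    simpa only [Tweight, sub_sub_sub_cancel_left] using slope_lt
end

section
/- Let 0 < γ < 1 and define y(t) = E_γ(−t^γ) for t ≥ 0, where E_γ(z) = Σ_{k=0}^∞ z^k / Γ(γk + 1) is the Mittag-Leffler function. Then y is differentiable on (0,∞), for every t > 0 the integral ∫_0^t (t − τ)^(−γ) y′(τ) dτ converges, and the Caputo fractional derivative of y satisfies the eigenfunction relation (1/Γ(1−γ)) ∫_0^t (t − τ)^(−γ) y′(τ) dτ = −E_γ(−t^γ) for all t > 0. -/
open MeasureTheory

/-- The (real) Mittag-Leffler function `E_γ(x) = Σ_{k=0}^∞ x^k / Γ(γk + 1)`. -/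
noncomputable def mittagLeffler (γ : ℝ) (x : ℝ) : ℝ :=
  ∑' k : ℕ, x ^ k / Real.Gamma (γ * k + 1)

/-- A power series that converges absolutely everywhere may be differentiated term by term. -/
lemma hasDerivAt_tsum_coeff_mul_pow {a : ℕ → ℝ}
    (ha : ∀ r : ℝ, 0 ≤ r → Summable fun k => |a k| * r ^ k) (x : ℝ) :
    HasDerivAt (fun z : ℝ => ∑' k, a k * z ^ k) (∑' k : ℕ, a k * (k * x ^ (k - 1))) x := by
  set R : ℝ := |x| + 1 with hR
  have hR1 : 1 ≤ R := by rw [hR]; linarith [abs_nonneg x]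
  refine hasDerivAt_tsum_of_isPreconnected (u := fun k => |a k| * (2 * R) ^ k)
    (t := Metric.ball 0 R) (y₀ := 0) (g' := fun k z => a k * (k * z ^ (k - 1)))
    (ha _ (by linarith)) Metric.isOpen_ball
    (convex_ball _ _).isPreconnected ?_ ?_ (by simp; linarith) ?_ (by simp [hR])
  · intro k z _
    exact (hasDerivAt_pow k z).const_mul (a k)
  · intro k z hz
    rw [mem_ball_zero_iff, Real.norm_eq_abs] at hz
    have h1 : |z| ^ (k - 1) ≤ R ^ k :=
      (pow_le_pow_left₀ (abs_nonneg z) hz.le _).trans (pow_le_pow_right₀ hR1 (Nat.sub_le k 1))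
    have h2 : (k : ℝ) ≤ 2 ^ k := by exact_mod_cast k.lt_two_pow_self.le
    rw [Real.norm_eq_abs, abs_mul, abs_mul, abs_pow, Nat.abs_cast, mul_pow]
    gcongr
  · exact Summable.of_norm (by simpa [abs_mul] using ha 0 le_rfl)

/-- The coefficients of the derivative of an everywhere convergent power series again define an
everywhere convergent power series. -/
lemma summable_abs_derivative_coeff_mul_pow {a : ℕ → ℝ}
    (ha : ∀ r : ℝ, 0 ≤ r → Summable fun k => |a k| * r ^ k) (r : ℝ) (hr : 0 ≤ r) :
    Summable fun k : ℕ => |a (k + 1) * (k + 1)| * r ^ k := by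
  have h := (summable_nat_add_iff 1).2 (ha (2 * (r + 1)) (by linarith))
  refine h.of_nonneg_of_le (fun k => by positivity) fun k => ?_
  have h2 : (k + 1 : ℝ) ≤ 2 ^ (k + 1) := by exact_mod_cast (k + 1).lt_two_pow_self.le
  have h1 : r ^ k ≤ (r + 1) ^ (k + 1) :=
    (pow_le_pow_left₀ hr (by linarith) _).trans (pow_le_pow_right₀ (by linarith) k.le_succ)
  rw [abs_mul, abs_of_nonneg (by positivity : (0 : ℝ) ≤ k + 1), mul_pow, mul_assoc]
  gcongr

lemma rpow_mul_exp_neg_le_Gamma_add_one {A x : ℝ} (hA : 0 < A) (hx : 0 ≤ x) :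
    A ^ x * Real.exp (-A) ≤ Real.Gamma (x + 1) := by
  have hint := Real.GammaIntegral_convergent (s := x + 1) (by linarith)
  rw [Real.Gamma_eq_integral (by linarith), ← integral_exp_neg_Ioi, ← integral_const_mul]
  have hsub : Set.Ioi A ⊆ Set.Ioi 0 := Set.Ioi_subset_Ioi hA.le
  refine (setIntegral_mono_on ((integrableOn_exp_neg_Ioi A).const_mul _) (hint.mono_set hsub)
    measurableSet_Ioi fun y hy => ?_).trans
    (setIntegral_mono_set hint ?_ hsub.eventuallyLE)
  · rw [mul_comm, add_sub_cancel_right]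
    have : A ≤ y := le_of_lt hy
    gcongr
  · filter_upwards [ae_restrict_mem measurableSet_Ioi] with y hy
    have : 0 ≤ y := le_of_lt hy
    simp only [Pi.zero_apply]
    positivity

lemma summable_mittagLeffler {γ : ℝ} (hγ : 0 < γ) (r : ℝ) (hr : 0 ≤ r) :
    Summable fun k : ℕ => |(Real.Gamma (γ * k + 1))⁻¹| * r ^ k := by
  set A : ℝ := (2 * (r + 1)) ^ (γ⁻¹) with hA
  have hApos : 0 < A := by positivity
  refine ((summable_geometric_two).mul_left (Real.exp A)).of_nonneg_of_le
    (fun k => by positivity) fun k => ?_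
  have hG := rpow_mul_exp_neg_le_Gamma_add_one hApos (x := γ * k) (by positivity)
  have hAk : A ^ (γ * k) = (2 * (r + 1)) ^ k := by
    rw [hA, ← Real.rpow_mul (by positivity), inv_mul_cancel_left₀ hγ.ne', Real.rpow_natCast]
  rw [hAk] at hG
  have hGpos : 0 < Real.Gamma (γ * k + 1) := Real.Gamma_pos_of_pos (by positivity)
  rw [abs_of_pos (inv_pos.2 hGpos), inv_mul_le_iff₀ hGpos]
  calc r ^ k ≤ (r + 1) ^ k := by gcongr; linarith
    _ = (2 * (r + 1)) ^ k * Real.exp (-A) * (Real.exp A * (1 / 2) ^ k) := by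
      rw [mul_pow, Real.exp_neg, one_div, inv_pow]; field_simp
    _ ≤ _ := by gcongr

lemma integral_rpow_mul_sub_rpow {u v t : ℝ} (hu : 0 < u) (hv : 0 < v) (ht : 0 < t) :
    ∫ x in (0 : ℝ)..t, x ^ (u - 1) * (t - x) ^ (v - 1) =
      t ^ (u + v - 1) * (Real.Gamma u * Real.Gamma v / Real.Gamma (u + v)) := by
  have h := Complex.betaIntegral_scaled u v ht
  rw [Complex.betaIntegral_eq_Gamma_mul_div _ _ (by simpa) (by simpa)] at h
  apply Complex.ofReal_injective
  rw [← intervalIntegral.integral_ofReal]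
  push_cast
  rw [Complex.ofReal_cpow ht.le, ← Complex.Gamma_ofReal, ← Complex.Gamma_ofReal,
    ← Complex.Gamma_ofReal]
  push_cast
  rw [← h]
  refine intervalIntegral.integral_congr fun x hx => ?_
  rw [Set.uIcc_of_le ht.le] at hx
  rw [Complex.ofReal_cpow hx.1, Complex.ofReal_cpow (sub_nonneg.2 hx.2)]
  push_cast
  rfl

lemma intervalIntegrable_rpow_mul_sub_rpow {u v t : ℝ} (hu : 0 < u) (hv : 0 < v) (ht : 0 < t) :
    IntervalIntegrable (fun x : ℝ => x ^ (u - 1) * (t - x) ^ (v - 1)) volume 0 t := by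
  apply intervalIntegral.intervalIntegrable_of_integral_ne_zero
  rw [integral_rpow_mul_sub_rpow hu hv ht]
  have := Real.Gamma_pos_of_pos hu
  have := Real.Gamma_pos_of_pos hv
  have := Real.Gamma_pos_of_pos (add_pos hu hv)
  positivity

/-- The derivative of the Mittag-Leffler function, as a power series. -/
noncomputable def mittagLefflerDeriv (γ x : ℝ) : ℝ :=
  ∑' k : ℕ, (Real.Gamma (γ * (k + 1 : ℕ) + 1))⁻¹ * (k + 1) * x ^ k

lemma hasDerivAt_mittagLeffler {γ : ℝ} (hγ : 0 < γ) (x : ℝ) :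
    HasDerivAt (mittagLeffler γ) (mittagLefflerDeriv γ x) x := by
  have hs := summable_mittagLeffler hγ
  have h := hasDerivAt_tsum_coeff_mul_pow hs x
  have hsum : Summable fun k : ℕ => (Real.Gamma (γ * k + 1))⁻¹ * (k * x ^ (k - 1)) := by
    rw [← summable_nat_add_iff 1]
    refine Summable.of_norm ?_
    simpa [abs_mul, mul_assoc] using summable_abs_derivative_coeff_mul_pow hs |x| (abs_nonneg x)
  rw [hsum.tsum_eq_zero_add] at h
  convert h using 1
  · ext z
    simp [mittagLeffler, div_eq_inv_mul]
  · simp [mittagLefflerDeriv, mul_assoc]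

lemma continuous_mittagLefflerDeriv {γ : ℝ} (hγ : 0 < γ) : Continuous (mittagLefflerDeriv γ) :=
  continuous_iff_continuousAt.2 fun x => (hasDerivAt_tsum_coeff_mul_pow
    (summable_abs_derivative_coeff_mul_pow (summable_mittagLeffler hγ)) x).continuousAt

lemma hasDerivAt_mittagLeffler_neg_rpow {γ s : ℝ} (hγ : 0 < γ) (hs : 0 < s) :
    HasDerivAt (fun s : ℝ => mittagLeffler γ (-(s ^ γ)))
      (mittagLefflerDeriv γ (-(s ^ γ)) * -(γ * s ^ (γ - 1))) s :=
  (hasDerivAt_mittagLeffler hγ _).comp s (Real.hasDerivAt_rpow_const (Or.inl hs.ne')).neg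

/-- The integrand in the Caputo derivative of the `k`-th nonconstant term of `E_γ(-s^γ)`. -/
noncomputable def caputoTerm (γ t : ℝ) (k : ℕ) (τ : ℝ) : ℝ :=
  (-1) ^ (k + 1) * (Real.Gamma (γ * (k + 1)))⁻¹ * (τ ^ (γ * (k + 1) - 1) * (t - τ) ^ (1 - γ - 1))

lemma caputoTerm_eq {γ t τ : ℝ} (hγ : 0 < γ) (hτ : 0 < τ) (k : ℕ) :
    caputoTerm γ t k τ = (t - τ) ^ (-γ) *
      ((Real.Gamma (γ * (k + 1 : ℕ) + 1))⁻¹ * (k + 1) * (-(τ ^ γ)) ^ k * -(γ * τ ^ (γ - 1))) := by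
  have hu : 0 < γ * ((k : ℝ) + 1) := by positivity
  have hpow : τ ^ (γ * (k + 1) - 1) = (τ ^ γ) ^ k * τ ^ (γ - 1) := by
    rw [← Real.rpow_natCast, ← Real.rpow_mul hτ.le, ← Real.rpow_add hτ]
    ring_nf
  have hG := Real.Gamma_pos_of_pos hu
  push_cast
  rw [caputoTerm, hpow, Real.Gamma_add_one hu.ne', neg_pow (τ ^ γ), pow_succ,
    show 1 - γ - 1 = -γ by ring]
  field_simp

lemma inv_Gamma_mul_integral_rpow_mul_sub_rpow {γ t : ℝ} (hγ0 : 0 < γ) (hγ1 : γ < 1) (ht : 0 < t) (k : ℕ) :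
    (Real.Gamma (γ * (k + 1)))⁻¹ *
        ∫ τ in (0 : ℝ)..t, τ ^ (γ * (k + 1) - 1) * (t - τ) ^ (1 - γ - 1) =
      Real.Gamma (1 - γ) * ((Real.Gamma (γ * k + 1))⁻¹ * (t ^ γ) ^ k) := by
  have hu : 0 < γ * ((k : ℝ) + 1) := by positivity
  have hG := Real.Gamma_pos_of_pos hu
  rw [integral_rpow_mul_sub_rpow hu (sub_pos.2 hγ1) ht,
    show γ * ((k : ℝ) + 1) + (1 - γ) = γ * k + 1 by ring, add_sub_cancel_right,
    Real.rpow_mul ht.le, Real.rpow_natCast]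
  field_simp

lemma hasSum_integral_caputoTerm {γ t : ℝ} (hγ0 : 0 < γ) (hγ1 : γ < 1) (ht : 0 < t) :
    HasSum (fun k => ∫ τ in (0 : ℝ)..t, caputoTerm γ t k τ)
      (∫ τ in (0 : ℝ)..t, ∑' k, caputoTerm γ t k τ) := by
  simp_rw [intervalIntegral.integral_of_le ht.le]
  refine hasSum_integral_of_summable_integral_norm (fun k => ?_) ?_
  · exact ((intervalIntegrable_rpow_mul_sub_rpow (by positivity) (sub_pos.2 hγ1) ht).1).const_mul _
  · refine ((summable_mittagLeffler hγ0 (t ^ γ) (by positivity)).mul_left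
      (Real.Gamma (1 - γ))).congr fun k => ?_
    have hG := Real.Gamma_pos_of_pos (by positivity : 0 < γ * ((k : ℝ) + 1))
    rw [abs_of_pos (inv_pos.2 (Real.Gamma_pos_of_pos (by positivity))),
      ← inv_Gamma_mul_integral_rpow_mul_sub_rpow hγ0 hγ1 ht, intervalIntegral.integral_of_le ht.le,
      ← integral_const_mul]
    refine setIntegral_congr_fun measurableSet_Ioc fun τ hτ => ?_
    have h1 := Real.rpow_nonneg hτ.1.le (γ * (k + 1) - 1)
    have h2 := Real.rpow_nonneg (sub_nonneg.2 hτ.2) (1 - γ - 1)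
    simp only [caputoTerm, norm_mul, norm_pow, norm_neg, norm_one, one_pow, one_mul,
      Real.norm_of_nonneg (inv_pos.2 hG).le, Real.norm_of_nonneg h1, Real.norm_of_nonneg h2]

/-- for `0 < γ < 1`, the function `y(t) = E_γ(−t^γ)` is
differentiable on `(0,∞)`, the Caputo integral converges for every `t > 0`,
and `y` satisfies the eigenfunction relation
`(1/Γ(1−γ)) ∫_0^t (t − τ)^(−γ) y′(τ) dτ = −E_γ(−t^γ)`. -/
theorem stmt_6 (γ : ℝ) (hγ0 : 0 < γ) (hγ1 : γ < 1) :
    DifferentiableOn ℝ (fun s : ℝ => mittagLeffler γ (-(s ^ γ))) (Set.Ioi 0) ∧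
    ∀ t : ℝ, 0 < t →
      IntervalIntegrable
        (fun τ : ℝ => (t - τ) ^ (-γ) * deriv (fun s : ℝ => mittagLeffler γ (-(s ^ γ))) τ)
        volume 0 t ∧
      (1 / Real.Gamma (1 - γ)) *
          ∫ τ in (0:ℝ)..t, (t - τ) ^ (-γ) * deriv (fun s : ℝ => mittagLeffler γ (-(s ^ γ))) τ
        = -(mittagLeffler γ (-(t ^ γ))) := by
  have hderiv : ∀ τ : ℝ, 0 < τ → deriv (fun s : ℝ => mittagLeffler γ (-(s ^ γ))) τ =
      mittagLefflerDeriv γ (-(τ ^ γ)) * -(γ * τ ^ (γ - 1)) :=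
    fun τ hτ => (hasDerivAt_mittagLeffler_neg_rpow hγ0 hτ).deriv
  refine ⟨fun s hs => (hasDerivAt_mittagLeffler_neg_rpow hγ0
    hs).differentiableAt.differentiableWithinAt, fun t ht => ⟨?_, ?_⟩⟩
  · have hcont : Continuous fun τ : ℝ => -γ * mittagLefflerDeriv γ (-(τ ^ γ)) :=
      continuous_const.mul ((continuous_mittagLefflerDeriv hγ0).comp
        (Real.continuous_rpow_const hγ0.le).neg)
    refine ((intervalIntegrable_rpow_mul_sub_rpow hγ0 (sub_pos.2 hγ1) ht).continuousOn_mul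
      hcont.continuousOn).congr fun τ hτ => ?_
    rw [Set.uIoc_of_le ht.le] at hτ
    rw [hderiv τ hτ.1, show 1 - γ - 1 = -γ by ring]
    ring
  · have hint : ∫ τ in (0:ℝ)..t,
        (t - τ) ^ (-γ) * deriv (fun s : ℝ => mittagLeffler γ (-(s ^ γ))) τ =
        ∫ τ in (0:ℝ)..t, ∑' k, caputoTerm γ t k τ := by
      simp_rw [intervalIntegral.integral_of_le ht.le]
      refine setIntegral_congr_fun measurableSet_Ioc fun τ hτ => ?_
      rw [hderiv τ hτ.1, mittagLefflerDeriv, ← tsum_mul_right, ← tsum_mul_left]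
      exact tsum_congr fun k => (caputoTerm_eq hγ0 hτ.1 k).symm
    have hG : Real.Gamma (1 - γ) ≠ 0 := (Real.Gamma_pos_of_pos (sub_pos.2 hγ1)).ne'
    rw [hint, ← (hasSum_integral_caputoTerm hγ0 hγ1 ht).tsum_eq, mittagLeffler, ← tsum_mul_left,
      ← tsum_neg]
    refine tsum_congr fun k => ?_
    simp only [caputoTerm]
    rw [intervalIntegral.integral_const_mul, mul_assoc ((-1) ^ (k + 1)),
      inv_Gamma_mul_integral_rpow_mul_sub_rpow hγ0 hγ1 ht, neg_pow (t ^ γ), pow_succ]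
    field_simp
end
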